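/- Let p, q, m, n be integers with p ≥ 2, |q| ≥ 3, p + 1 < m < 2p − 1, and 2n − 1 ≥ |q|, and let a ∈ ℝ. Then the following holds if and only if |q| − n ≤ |a| ≤ |q|(n−1)/(|q|−2): either (1) for every i ∈ {0, …, m−2} and every j ∈ {0, …, n−2} both S_{i,j}(T) ∩ S_{i+1,j}(T) ≠ ∅ and S_{i,j}(T) ∩ S_{i+1,j+1}(T) ≠ ∅, or (2) for every i ∈ {0, …, m−2} and every j ∈ {0, …, n−2} both S_{i,j}(T) ∩ S_{i+1,j}(T) ≠ ∅ and S_{i,j+1}(T) ∩ S_{i+1,j}(T) ≠ ∅. -/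

import Mathlib

open Matrix

/-- The expanding matrix with rows `(p, 0)` and `(-a, q)`. -/
noncomputable def matA (p q : ℤ) (a : ℝ) : Matrix (Fin 2) (Fin 2) ℝ :=
  !![(p : ℝ), 0; -a, (q : ℝ)]

/-- The product digit set `{0,…,m-1} × {0,…,n-1}` viewed inside `ℝ²`. -/
def digitSet (m n : ℤ) : Set (Fin 2 → ℝ) :=
  {v | ∃ i j : ℤ, 0 ≤ i ∧ i ≤ m - 1 ∧ 0 ≤ j ∧ j ≤ n - 1 ∧ v = ![(i : ℝ), (j : ℝ)]}

/-- `T(A, D) = { ∑_{k≥1} A^{-k} d_k : d_k ∈ D }`. -/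
noncomputable def selfAffineSet (A : Matrix (Fin 2) (Fin 2) ℝ) (D : Set (Fin 2 → ℝ)) :
    Set (Fin 2 → ℝ) :=
  {x | ∃ d : ℕ → (Fin 2 → ℝ), (∀ k, d k ∈ D) ∧
    HasSum (fun k => (A⁻¹ ^ (k + 1)).mulVec (d k)) x}

/-- `S_{i,j}(T) = A⁻¹(T + (i, j))`. -/
noncomputable def Sij (A : Matrix (Fin 2) (Fin 2) ℝ) (T : Set (Fin 2 → ℝ)) (i j : ℤ) :
    Set (Fin 2 → ℝ) :=
  (fun x => A⁻¹.mulVec (x + ![(i : ℝ), (j : ℝ)])) '' T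

/-- `G_i(T) = ⋃_{j=0}^{n-1} S_{i,j}(T)`. -/
noncomputable def Gi (A : Matrix (Fin 2) (Fin 2) ℝ) (T : Set (Fin 2 → ℝ)) (n i : ℤ) :
    Set (Fin 2 → ℝ) :=
  ⋃ j ∈ Set.Icc (0 : ℤ) (n - 1), Sij A T i j

lemma aux_sup {V : Type*} (W : Set V) (f : V → ℝ) (C b c : ℝ) (hc : 1 < c)
    (hC : ∀ z ∈ W, f z ≤ C) (h : ∀ z ∈ W, ∃ z' ∈ W, c * f z ≤ b + f z') :
    ∀ z ∈ W, (c - 1) * f z ≤ b := by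
  intro z hz
  have hbdd : BddAbove (f '' W) := ⟨C, by rintro _ ⟨y, hy, rfl⟩; exact hC y hy⟩
  have hne : (f '' W).Nonempty := ⟨_, z, hz, rfl⟩
  have hle : ∀ y ∈ W, f y ≤ sSup (f '' W) := fun y hy => le_csSup hbdd ⟨y, hy, rfl⟩
  have h1 : sSup (f '' W) ≤ (b + sSup (f '' W)) / c := by
    apply csSup_le hne
    rintro _ ⟨y, hy, rfl⟩
    obtain ⟨z', hz', h'⟩ := h y hy
    rw [le_div_iff₀ (by linarith)]
    linarith [hle z' hz']
  rw [le_div_iff₀ (by linarith)] at h1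
  have h2 := hle z hz
  nlinarith

section
variable {p q m n : ℤ} {a : ℝ}

lemma detA (hp : 2 ≤ p) (hq : 3 ≤ |q|) : IsUnit (matA p q a).det := by
  have hq0 : q ≠ 0 := by rintro rfl; simp at hq
  have hp0 : p ≠ 0 := by omega
  simp [matA, Matrix.det_fin_two_of, hq0, hp0]

lemma A_mulVec (v : Fin 2 → ℝ) :
    (matA p q a) *ᵥ v = ![(p : ℝ) * v 0, -a * v 0 + q * v 1] := by
  ext i; fin_cases i <;> simp [matA, Matrix.mulVec, dotProduct, Fin.sum_univ_two]

lemma AB (hp : 2 ≤ p) (hq : 3 ≤ |q|) (v : Fin 2 → ℝ) :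
    (matA p q a) *ᵥ ((matA p q a)⁻¹ *ᵥ v) = v := by
  rw [Matrix.mulVec_mulVec, Matrix.mul_nonsing_inv _ (detA hp hq), Matrix.one_mulVec]

lemma BA (hp : 2 ≤ p) (hq : 3 ≤ |q|) (v : Fin 2 → ℝ) :
    (matA p q a)⁻¹ *ᵥ ((matA p q a) *ᵥ v) = v := by
  rw [Matrix.mulVec_mulVec, Matrix.nonsing_inv_mul _ (detA hp hq), Matrix.one_mulVec]

lemma B_contr (hp : 2 ≤ p) (hq : 3 ≤ |q|) (R : ℝ) (v : Fin 2 → ℝ)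
    (h0 : |v 0| ≤ R) (h1 : |v 1| ≤ (|a| + 1) * R) :
    |((matA p q a)⁻¹ *ᵥ v) 0| ≤ R / 2 ∧ |((matA p q a)⁻¹ *ᵥ v) 1| ≤ (|a| + 1) * (R / 2) := by
  have h := AB (a := a) hp hq v
  set w := (matA p q a)⁻¹ *ᵥ v with hw
  rw [A_mulVec] at h
  have e0 : (p : ℝ) * w 0 = v 0 := by simpa using congrFun h 0
  have e1 : -a * w 0 + q * w 1 = v 1 := by simpa using congrFun h 1
  have hp' : (2 : ℝ) ≤ p := by exact_mod_cast hp
  have hq' : (3 : ℝ) ≤ |(q : ℝ)| := by exact_mod_cast hq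
  have k0 : |w 0| ≤ R / 2 := by
    have : (p : ℝ) * |w 0| ≤ R := by
      rw [← e0, abs_mul, abs_of_nonneg (by linarith : (0 : ℝ) ≤ p)] at h0; exact h0
    nlinarith [abs_nonneg (w 0)]
  refine ⟨k0, ?_⟩
  have k1 : |(q : ℝ)| * |w 1| ≤ (|a| + 1) * R + |a| * (R / 2) := by
    rw [← abs_mul]
    have : (q : ℝ) * w 1 = v 1 + a * w 0 := by linarith
    rw [this]
    refine (abs_add_le _ _).trans ?_
    rw [abs_mul]
    have := mul_le_mul_of_nonneg_left k0 (abs_nonneg a)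
    linarith
  have hR : 0 ≤ R := (abs_nonneg _).trans h0
  nlinarith [abs_nonneg (w 1), abs_nonneg a, mul_nonneg (abs_nonneg a) hR]

lemma B_pow (hp : 2 ≤ p) (hq : 3 ≤ |q|) (R : ℝ) (v : Fin 2 → ℝ)
    (h0 : |v 0| ≤ R) (h1 : |v 1| ≤ (|a| + 1) * R) (k : ℕ) :
    |((matA p q a)⁻¹ ^ k *ᵥ v) 0| ≤ R / 2 ^ k ∧
      |((matA p q a)⁻¹ ^ k *ᵥ v) 1| ≤ (|a| + 1) * (R / 2 ^ k) := by
  induction k with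
  | zero => simpa using ⟨h0, h1⟩
  | succ k ih =>
    have := B_contr (a := a) hp hq _ _ ih.1 ih.2
    rw [pow_succ', ← Matrix.mulVec_mulVec, pow_succ, ← div_div]
    exact this

lemma B_norm (hp : 2 ≤ p) (hq : 3 ≤ |q|) (R : ℝ) (v : Fin 2 → ℝ)
    (h : ‖v‖ ≤ R) (k : ℕ) :
    ‖(matA p q a)⁻¹ ^ k *ᵥ v‖ ≤ (|a| + 1) * R / 2 ^ k := by
  have hR : 0 ≤ R := (norm_nonneg _).trans h
  have h0 : |v 0| ≤ R := (norm_le_pi_norm v 0).trans h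
  have h1 : |v 1| ≤ R := (norm_le_pi_norm v 1).trans h
  have ha := abs_nonneg a
  obtain ⟨k0, k1⟩ := B_pow (a := a) hp hq R v h0 (by nlinarith) k
  have hR2 : 0 ≤ R / 2 ^ k := by positivity
  rw [pi_norm_le_iff_of_nonneg (by positivity)]
  rw [mul_div_assoc]
  intro i
  fin_cases i
  · simp only [Real.norm_eq_abs]; exact k0.trans (by nlinarith)
  · exact k1

lemma digit_norm {d : Fin 2 → ℝ} (hd : d ∈ digitSet m n) : ‖d‖ ≤ (m : ℝ) + n := by
  obtain ⟨i, j, hi0, hi, hj0, hj, rfl⟩ := hd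
  have a1 : (0 : ℝ) ≤ i := by exact_mod_cast hi0
  have a2 : (i : ℝ) ≤ m - 1 := by exact_mod_cast hi
  have a3 : (0 : ℝ) ≤ j := by exact_mod_cast hj0
  have a4 : (j : ℝ) ≤ n - 1 := by exact_mod_cast hj
  rw [pi_norm_le_iff_of_nonneg (by linarith)]
  intro i
  fin_cases i
  · simp [abs_of_nonneg a1]; linarith
  · simp [abs_of_nonneg a3]; linarith

lemma term_norm (hp : 2 ≤ p) (hq : 3 ≤ |q|) {d : Fin 2 → ℝ} (hd : d ∈ digitSet m n) (k : ℕ) :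
    ‖(matA p q a)⁻¹ ^ (k + 1) *ᵥ d‖ ≤ (|a| + 1) * ((m : ℝ) + n) / 2 / 2 ^ k := by
  have := B_norm (a := a) hp hq _ d (digit_norm hd) (k + 1)
  rwa [pow_succ' (2 : ℝ), ← div_div] at this

lemma T_bdd (hp : 2 ≤ p) (hq : 3 ≤ |q|) {x : Fin 2 → ℝ}
    (hx : x ∈ selfAffineSet (matA p q a) (digitSet m n)) :
    ‖x‖ ≤ (|a| + 1) * ((m : ℝ) + n) := by
  obtain ⟨d, hd, hs⟩ := hx
  exact hs.norm_le_of_bounded (hasSum_geometric_two' _) (fun k => term_norm hp hq (hd k) k)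

lemma T_summable (hp : 2 ≤ p) (hq : 3 ≤ |q|) {d : ℕ → Fin 2 → ℝ}
    (hd : ∀ k, d k ∈ digitSet m n) :
    Summable (fun k => (matA p q a)⁻¹ ^ (k + 1) *ᵥ d k) :=
  Summable.of_norm_bounded (summable_geometric_two' ((|a| + 1) * ((m : ℝ) + n)))
    (fun k => term_norm hp hq (hd k) k)

lemma T_step (hp : 2 ≤ p) (hq : 3 ≤ |q|) {x : Fin 2 → ℝ}
    (hx : x ∈ selfAffineSet (matA p q a) (digitSet m n)) :
    ∃ d ∈ digitSet m n, matA p q a *ᵥ x - d ∈ selfAffineSet (matA p q a) (digitSet m n) := by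
  obtain ⟨d, hd, hs⟩ := hx
  refine ⟨d 0, hd 0, fun k => d (k + 1), fun k => hd _, ?_⟩
  have h1 := (hasSum_nat_add_iff' 1).2 hs
  have h2 := h1.map (Matrix.mulVecLin (matA p q a)) (Matrix.mulVecLin (matA p q a)).continuous_of_finiteDimensional
  convert h2 using 1
  · ext1 k
    simp only [Function.comp, Matrix.mulVecLin_apply]
    rw [pow_succ' _ (k + 1), ← Matrix.mulVec_mulVec, AB hp hq]
  · rw [Matrix.mulVecLin_apply, Finset.sum_range_one, zero_add, pow_one, Matrix.mulVec_sub, AB hp hq]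

lemma W_step (hp : 2 ≤ p) (hq : 3 ≤ |q|) {x y : Fin 2 → ℝ}
    (hx : x ∈ selfAffineSet (matA p q a) (digitSet m n))
    (hy : y ∈ selfAffineSet (matA p q a) (digitSet m n)) :
    ∃ x' ∈ selfAffineSet (matA p q a) (digitSet m n),
    ∃ y' ∈ selfAffineSet (matA p q a) (digitSet m n), ∃ e f : ℤ,
      |(e : ℝ)| ≤ m - 1 ∧ |(f : ℝ)| ≤ n - 1 ∧ (x' - y') 0 = p * (x - y) 0 - e ∧
      (x' - y') 1 = -a * (x - y) 0 + q * (x - y) 1 - f := by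
  obtain ⟨d, ⟨i, j, hi0, hi, hj0, hj, rfl⟩, hd⟩ := T_step hp hq hx
  obtain ⟨d', ⟨i', j', hi0', hi', hj0', hj', rfl⟩, hd'⟩ := T_step hp hq hy
  refine ⟨_, hd, _, hd', i - i', j - j', ?_, ?_, ?_, ?_⟩
  · have : |i - i'| ≤ m - 1 := by rw [abs_le]; omega
    exact_mod_cast this
  · have : |j - j'| ≤ n - 1 := by rw [abs_le]; omega
    exact_mod_cast this
  · simp only [A_mulVec, Pi.sub_apply]; simp; ring
  · simp only [A_mulVec, Pi.sub_apply]; simp; ring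

/-- necessity engine -/
lemma nec (hp : 2 ≤ p) (hq : 3 ≤ |q|) (hm2 : m < 2 * p - 1) {x y : Fin 2 → ℝ}
    (hx : x ∈ selfAffineSet (matA p q a) (digitSet m n))
    (hy : y ∈ selfAffineSet (matA p q a) (digitSet m n)) (u : ℤ) (hu : (x - y) 0 = u) :
    (|(q : ℝ)| - 1) * |(x - y) 1| ≤ |a| + (n - 1) := by
  have hp' : (2 : ℝ) ≤ p := by exact_mod_cast hp
  have hq' : (3 : ℝ) ≤ |(q : ℝ)| := by exact_mod_cast hq
  have hm' : (m : ℝ) < 2 * p - 1 := by exact_mod_cast hm2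
  let W : Set (Fin 2 → ℝ) := {z | ∃ x ∈ selfAffineSet (matA p q a) (digitSet m n),
    ∃ y ∈ selfAffineSet (matA p q a) (digitSet m n), ∃ u : ℤ, z = x - y ∧ z 0 = u}
  have hstep : ∀ z ∈ W, ∃ z' ∈ W, ∃ e f : ℤ,
      |(e : ℝ)| ≤ m - 1 ∧ |(f : ℝ)| ≤ n - 1 ∧ z' 0 = p * z 0 - e ∧
      z' 1 = -a * z 0 + q * z 1 - f := by
    rintro z ⟨x, hx, y, hy, u, rfl, hu⟩
    obtain ⟨x', hx', y', hy', e, f, he, hf, h0, h1⟩ := W_step hp hq hx hy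
    refine ⟨x' - y', ⟨x', hx', y', hy', p * u - e, rfl, ?_⟩, e, f, he, hf, h0, h1⟩
    rw [h0, hu]; push_cast; ring
  have hb : ∀ z ∈ W, ∀ i, |z i| ≤ 2 * ((|a| + 1) * ((m : ℝ) + n)) := by
    rintro z ⟨x, hx, y, hy, u, rfl, hu⟩ i
    have := norm_le_pi_norm (x - y) i
    have h2 := norm_sub_le x y
    have h3 := T_bdd hp hq hx
    have h4 := T_bdd hp hq hy
    rw [Real.norm_eq_abs] at this
    linarith
  have hU := aux_sup W (fun z => |z 0|) _ (m - 1) p (by linarith) (fun z hz => hb z hz 0) (by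
    intro z hz
    obtain ⟨z', hz', e, f, he, hf, h0, h1⟩ := hstep z hz
    refine ⟨z', hz', ?_⟩
    have : (p : ℝ) * |z 0| = |e + z' 0| := by
      rw [h0, add_sub_cancel, abs_mul, abs_of_nonneg (by linarith : (0 : ℝ) ≤ p)]
    show (p : ℝ) * |z 0| ≤ m - 1 + |z' 0|
    rw [this]
    linarith [abs_add_le (e : ℝ) (z' 0)])
  have hU1 : ∀ z ∈ W, |z 0| ≤ 1 := by
    intro z hz
    have h := hU z hz
    obtain ⟨x, hx, y, hy, u, rfl, hu⟩ := hz
    simp only [hu] at h ⊢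
    have : |(u : ℝ)| < 2 := by nlinarith [abs_nonneg (u : ℝ)]
    have : |u| < 2 := by exact_mod_cast this
    exact_mod_cast (by omega : |u| ≤ 1)
  refine aux_sup W (fun z => |z 1|) _ (|a| + (n - 1)) |(q : ℝ)| (by linarith)
    (fun z hz => hb z hz 1) ?_ (x - y) ⟨x, hx, y, hy, u, rfl, hu⟩
  intro z hz
  obtain ⟨z', hz', e, f, he, hf, h0, h1⟩ := hstep z hz
  refine ⟨z', hz', ?_⟩
  show |(q : ℝ)| * |z 1| ≤ |a| + (n - 1) + |z' 1|
  have e1 : (q : ℝ) * z 1 = z' 1 + a * z 0 + f := by rw [h1]; ring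
  rw [← abs_mul, e1]
  have k1 := abs_add_le (z' 1 + a * z 0) (f : ℝ)
  have k2 := abs_add_le (z' 1) (a * z 0)
  rw [abs_mul] at k2
  have k3 := mul_le_mul_of_nonneg_left (hU1 z hz) (abs_nonneg a)
  linarith

lemma digit_split {N e : ℤ} (h : |e| ≤ N) : ∃ i i' : ℤ, 0 ≤ i ∧ i ≤ N ∧ 0 ≤ i' ∧ i' ≤ N ∧ e = i - i' := by
  rw [abs_le] at h
  rcases le_total 0 e with h' | h'
  · exact ⟨e, 0, by omega, by omega, by omega, by omega, by omega⟩
  · exact ⟨0, -e, by omega, by omega, by omega, by omega, by omega⟩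

/-- converse engine: a bounded orbit gives a difference of points in T -/
lemma orbit (hp : 2 ≤ p) (hq : 3 ≤ |q|) (v : ℕ → Fin 2 → ℝ) (e f : ℕ → ℤ) (C : ℝ)
    (hC : ∀ k, ‖v k‖ ≤ C) (he : ∀ k, |e k| ≤ m - 1) (hf : ∀ k, |f k| ≤ n - 1)
    (h0 : ∀ k, v (k + 1) 0 = p * v k 0 - e k)
    (h1 : ∀ k, v (k + 1) 1 = -a * v k 0 + q * v k 1 - f k) :
    ∃ x ∈ selfAffineSet (matA p q a) (digitSet m n),
    ∃ y ∈ selfAffineSet (matA p q a) (digitSet m n), x - y = v 0 := by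
  choose i i' hi0 hi hi0' hi' hie using fun k => digit_split (he k)
  choose j j' hj0 hj hj0' hj' hjf using fun k => digit_split (hf k)
  let d : ℕ → Fin 2 → ℝ := fun k => ![(i k : ℝ), (j k : ℝ)]
  let d' : ℕ → Fin 2 → ℝ := fun k => ![(i' k : ℝ), (j' k : ℝ)]
  have hd : ∀ k, d k ∈ digitSet m n := fun k => ⟨i k, j k, hi0 k, hi k, hj0 k, hj k, rfl⟩
  have hd' : ∀ k, d' k ∈ digitSet m n := fun k => ⟨i' k, j' k, hi0' k, hi' k, hj0' k, hj' k, rfl⟩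
  have s := (T_summable (a := a) hp hq hd).hasSum
  have s' := (T_summable (a := a) hp hq hd').hasSum
  refine ⟨_, ⟨d, hd, s⟩, _, ⟨d', hd', s'⟩, ?_⟩
  have t := (s.sub s').tendsto_sum_nat
  have hv : ∀ k, v k = (matA p q a)⁻¹ *ᵥ ((d k - d' k) + v (k + 1)) := by
    intro k
    conv_lhs => rw [← BA (a := a) hp hq (v k)]
    congr 1
    rw [A_mulVec]
    ext l
    fin_cases l
    · simp [d, d', h0, hie]
    · simp [d, d', h1, hjf]
  have hpart : ∀ N, ∑ k ∈ Finset.range N, ((matA p q a)⁻¹ ^ (k + 1) *ᵥ d k -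
      (matA p q a)⁻¹ ^ (k + 1) *ᵥ d' k) = v 0 - (matA p q a)⁻¹ ^ N *ᵥ v N := by
    intro N
    induction N with
    | zero => simp
    | succ N ih =>
      rw [Finset.sum_range_succ, ih, hv N, Matrix.mulVec_mulVec, ← pow_succ, Matrix.mulVec_add,
        Matrix.mulVec_sub]
      abel
  have hz : Filter.Tendsto (fun N => (matA p q a)⁻¹ ^ N *ᵥ v N) Filter.atTop (nhds 0) := by
    refine squeeze_zero_norm (a := fun N => (|a| + 1) * C / 2 ^ N)
      (fun N => B_norm hp hq C (v N) (hC N) N) ?_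
    have := (tendsto_pow_atTop_nhds_zero_of_lt_one (r := (1/2 : ℝ)) (by norm_num)
      (by norm_num)).const_mul ((|a| + 1) * C)
    simpa [div_eq_mul_inv] using this
  refine tendsto_nhds_unique t ?_
  simp only [hpart]
  simpa using tendsto_const_nhds.sub hz

lemma unit_cover (N : ℤ) (hN : 0 ≤ N) (M t : ℝ) (hM : 1 / 2 ≤ M) (ht : |t| ≤ N + M) :
    ∃ f : ℤ, |f| ≤ N ∧ |t - f| ≤ M := by
  have hr := abs_sub_round t
  rw [abs_le] at ht hr
  by_cases h : |round t| ≤ N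
  · exact ⟨round t, h, (abs_sub_round t).trans hM⟩
  · rw [abs_le, not_and_or] at h
    rcases h with h | h
    · have : ((round t : ℤ) : ℝ) ≤ -N - 1 := by exact_mod_cast (by omega : round t ≤ -N - 1)
      refine ⟨-N, by rw [abs_neg, abs_of_nonneg hN], ?_⟩
      push_cast
      rw [abs_le]; constructor <;> linarith
    · have : (N : ℝ) + 1 ≤ ((round t : ℤ) : ℝ) := by exact_mod_cast (by omega : N + 1 ≤ round t)
      refine ⟨N, by rw [abs_of_nonneg hN], ?_⟩
      rw [abs_le]; constructor <;> linarith

lemma full_cover (N : ℤ) (hN : 0 ≤ N) (M t : ℝ) (hM : 1 / 2 ≤ M) (ha : |a| ≤ N + M)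
    (ht : |t| ≤ N + M + |a|) :
    ∃ r f : ℤ, |r| ≤ 1 ∧ |f| ≤ N ∧ |t - a * r - f| ≤ M := by
  have hN' : (0 : ℝ) ≤ N := by exact_mod_cast hN
  have key : ∃ r : ℤ, |r| ≤ 1 ∧ |t - a * r| ≤ N + M := by
    rw [abs_le] at ht
    by_cases h : |t| ≤ N + M
    · exact ⟨0, by simp, by simpa using h⟩
    · rw [abs_le, not_and_or] at h
      rcases abs_cases a with ⟨h1, h2⟩ | ⟨h1, h2⟩ <;> rw [h1] at ht ha <;> rcases h with h | h
      · exact ⟨-1, by simp, by rw [abs_le]; push_cast; constructor <;> linarith⟩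
      · exact ⟨1, by simp, by rw [abs_le]; push_cast; constructor <;> linarith⟩
      · exact ⟨1, by simp, by rw [abs_le]; push_cast; constructor <;> linarith⟩
      · exact ⟨-1, by simp, by rw [abs_le]; push_cast; constructor <;> linarith⟩
  obtain ⟨r, hr, h⟩ := key
  obtain ⟨f, hf, h'⟩ := unit_cover N hN M _ hM h
  exact ⟨r, f, hr, hf, h'⟩

/-- sufficiency engine -/
lemma suff (hp : 2 ≤ p) (hq : 3 ≤ |q|) (hm1 : p + 1 < m) (hn : |q| ≤ 2 * n - 1)
    (M : ℝ) (hM : (|(q : ℝ)| - 1) * M = |a| + (n - 1)) (ha : |a| ≤ (n - 1) + M) (s : ℝ)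
    (hs : |q * s - a| ≤ (n - 1) + M) :
    ∃ x ∈ selfAffineSet (matA p q a) (digitSet m n),
    ∃ y ∈ selfAffineSet (matA p q a) (digitSet m n), x - y = ![1, s] := by
  have hq' : (3 : ℝ) ≤ |(q : ℝ)| := by exact_mod_cast hq
  have hn' : |(q : ℝ)| ≤ 2 * n - 1 := by exact_mod_cast hn
  have hM2 : 1 / 2 ≤ M := by nlinarith [abs_nonneg a]
  have hN : 0 ≤ n - 1 := by omega
  have ha' : |a| ≤ ((n - 1 : ℤ) : ℝ) + M := by push_cast; exact ha
  have hcov : ∀ w : ℝ, ∃ r f : ℤ, |r| ≤ 1 ∧ |f| ≤ n - 1 ∧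
      (|w| ≤ M → |q * w - a * r - f| ≤ M) := by
    intro w
    by_cases hw : |w| ≤ M
    · obtain ⟨r, f, h1, h2, h3⟩ := full_cover (a := a) (n - 1) hN M (q * w) hM2 ha' (by
        rw [abs_mul]; push_cast
        have := mul_le_mul_of_nonneg_left hw (abs_nonneg (q : ℝ))
        linarith)
      exact ⟨r, f, h1, h2, fun _ => h3⟩
    · exact ⟨0, 0, by simp, by simpa using hN, fun h => absurd h hw⟩
  choose r f hr hf hrf using hcov
  obtain ⟨f0, hf0, hw1⟩ := unit_cover (n - 1) hN M (q * s - a) hM2 (by push_cast; exact hs)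
  let g : ℝ → ℝ := fun w => q * w - a * r w - f w
  let w : ℕ → ℝ := fun k => g^[k] (q * s - a - f0)
  have hw0 : w 0 = q * s - a - f0 := rfl
  have hws : ∀ k, w (k + 1) = q * w k - a * r (w k) - f (w k) := by
    intro k; simp only [w, Function.iterate_succ_apply']; rfl
  have hwM : ∀ k, |w k| ≤ M := by
    intro k
    induction k with
    | zero => rw [hw0]; exact hw1
    | succ k ih => rw [hws]; exact hrf _ ih
  obtain ⟨R, hR0, hRs⟩ : ∃ R : ℕ → ℤ, R 0 = 1 ∧ ∀ k, R (k + 1) = r (w k) :=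
    ⟨fun k => Nat.casesOn k 1 (fun k => r (w k)), rfl, fun _ => rfl⟩
  obtain ⟨V, hV0, hVs'⟩ : ∃ V : ℕ → ℝ, V 0 = s ∧ ∀ k, V (k + 1) = w k :=
    ⟨fun k => Nat.casesOn k s (fun k => w k), rfl, fun _ => rfl⟩
  obtain ⟨F, hF0, hFs⟩ : ∃ F : ℕ → ℤ, F 0 = f0 ∧ ∀ k, F (k + 1) = f (w k) :=
    ⟨fun k => Nat.casesOn k f0 (fun k => f (w k)), rfl, fun _ => rfl⟩
  have hR : ∀ k, |R k| ≤ 1 := by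
    intro k; cases k
    · simp [hR0]
    · rw [hRs]; exact hr _
  have hF : ∀ k, |F k| ≤ n - 1 := by
    intro k; cases k
    · rw [hF0]; exact hf0
    · rw [hFs]; exact hf _
  have hV : ∀ k, |V k| ≤ |s| + M := by
    intro k; cases k
    · rw [hV0]; linarith
    · rw [hVs']; exact (hwM _).trans (by linarith [abs_nonneg s])
  have hVs : ∀ k, V (k + 1) = -a * R k + q * V k - F k := by
    intro k; cases k with
    | zero => rw [hVs', hV0, hF0, hR0, hw0]; push_cast; ring
    | succ k => rw [hVs', hVs', hRs, hFs, hws]; ring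
  have := orbit (m := m) (n := n) (a := a) hp hq (fun k => ![(R k : ℝ), V k])
    (fun k => p * R k - R (k + 1)) F (1 + |s| + M) ?_ ?_ hF ?_ ?_
  · simpa [hR0, hV0] using this
  · intro k
    have h1 : |(R k : ℝ)| ≤ 1 := by exact_mod_cast hR k
    have h2 := hV k
    rw [pi_norm_le_iff_of_nonneg (by positivity)]
    intro l
    fin_cases l
    · simp; linarith [abs_nonneg s]
    · simp; linarith
  · intro k
    have h1 := hR k
    have h2 := hR (k + 1)
    rw [abs_le] at h1 h2 ⊢
    constructor <;> nlinarith
  · intro k; simp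
  · intro k; simpa using hVs k

lemma inter_iff (hp : 2 ≤ p) (hq : 3 ≤ |q|) (T : Set (Fin 2 → ℝ)) (i j i' j' : ℤ) :
    (Sij (matA p q a) T i j ∩ Sij (matA p q a) T i' j').Nonempty ↔
      ∃ x ∈ T, ∃ y ∈ T, x - y = ![((i' - i : ℤ) : ℝ), ((j' - j : ℤ) : ℝ)] := by
  have key : ∀ x y : Fin 2 → ℝ, x - y = ![((i' - i : ℤ) : ℝ), ((j' - j : ℤ) : ℝ)] ↔
      x + ![(i : ℝ), (j : ℝ)] = y + ![(i' : ℝ), (j' : ℝ)] := by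
    intro x y
    simp only [funext_iff, Fin.forall_fin_two]
    simp
    constructor <;> rintro ⟨h1, h2⟩ <;> constructor <;> linarith
  constructor
  · rintro ⟨z, ⟨x, hx, rfl⟩, ⟨y, hy, h⟩⟩
    refine ⟨x, hx, y, hy, (key x y).2 ?_⟩
    have := congrArg (fun v => matA p q a *ᵥ v) h
    simp only [AB hp hq] at this
    exact this.symm
  · rintro ⟨x, hx, y, hy, h⟩
    refine ⟨_, ⟨x, hx, rfl⟩, ⟨y, hy, ?_⟩⟩
    simp only [(key x y).1 h]

lemma nec_zero (hp : 2 ≤ p) (hq : 3 ≤ |q|) (hm2 : m < 2 * p - 1) {x y : Fin 2 → ℝ}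
    (hx : x ∈ selfAffineSet (matA p q a) (digitSet m n))
    (hy : y ∈ selfAffineSet (matA p q a) (digitSet m n)) (h : x - y = ![1, 0]) :
    |a| ≤ |(q : ℝ)| * ((n : ℝ) - 1) / (|(q : ℝ)| - 2) := by
  have hq' : (3 : ℝ) ≤ |(q : ℝ)| := by exact_mod_cast hq
  obtain ⟨x', hx', y', hy', e, f, he, hf, h0, h1⟩ := W_step hp hq hx hy
  have := nec hp hq hm2 hx' hy' (p - e) (by rw [h0, h]; simp)
  rw [h1, h] at this
  simp at this
  have k : |a| ≤ |-a - (f : ℝ)| + |(f : ℝ)| := by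
    have := abs_add_le (-a - (f : ℝ)) f
    rwa [sub_add_cancel, abs_neg] at this
  rw [le_div_iff₀ (by linarith)]
  nlinarith

lemma nec_one (hp : 2 ≤ p) (hq : 3 ≤ |q|) (hm2 : m < 2 * p - 1) {x y : Fin 2 → ℝ}
    (hx : x ∈ selfAffineSet (matA p q a) (digitSet m n))
    (hy : y ∈ selfAffineSet (matA p q a) (digitSet m n)) (s : ℝ) (hs : |s| = 1)
    (h : x - y = ![1, s]) :
    |(q : ℝ)| - n ≤ |a| := by
  have := nec hp hq hm2 hx hy 1 (by rw [h]; simp)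
  rw [h] at this
  simp [hs] at this
  linarith

end

theorem stmt_13 (p q m n : ℤ) (a : ℝ) (hp : 2 ≤ p) (hq : 3 ≤ |q|)
    (hm1 : p + 1 < m) (hm2 : m < 2 * p - 1) (hn : |q| ≤ 2 * n - 1) :
    ((∀ i ∈ Set.Icc (0 : ℤ) (m - 2), ∀ j ∈ Set.Icc (0 : ℤ) (n - 2),
        (Sij (matA p q a) (selfAffineSet (matA p q a) (digitSet m n)) i j ∩
          Sij (matA p q a) (selfAffineSet (matA p q a) (digitSet m n)) (i + 1) j).Nonempty ∧
        (Sij (matA p q a) (selfAffineSet (matA p q a) (digitSet m n)) i j ∩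
          Sij (matA p q a) (selfAffineSet (matA p q a) (digitSet m n)) (i + 1) (j + 1)).Nonempty) ∨
      (∀ i ∈ Set.Icc (0 : ℤ) (m - 2), ∀ j ∈ Set.Icc (0 : ℤ) (n - 2),
        (Sij (matA p q a) (selfAffineSet (matA p q a) (digitSet m n)) i j ∩
          Sij (matA p q a) (selfAffineSet (matA p q a) (digitSet m n)) (i + 1) j).Nonempty ∧
        (Sij (matA p q a) (selfAffineSet (matA p q a) (digitSet m n)) i (j + 1) ∩
          Sij (matA p q a) (selfAffineSet (matA p q a) (digitSet m n)) (i + 1) j).Nonempty)) ↔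
    ((|q| : ℝ) - (n : ℝ) ≤ |a| ∧ |a| ≤ (|q| : ℝ) * ((n : ℝ) - 1) / ((|q| : ℝ) - 2)) := by
  have hq' : (3 : ℝ) ≤ |(q : ℝ)| := by exact_mod_cast hq
  simp only [inter_iff hp hq]
  constructor
  · rintro (h | h)
    · obtain ⟨⟨x, hx, y, hy, h1⟩, ⟨x', hx', y', hy', h2⟩⟩ :=
        h 0 ⟨le_refl _, by omega⟩ 0 ⟨le_refl _, by omega⟩
      exact ⟨nec_one hp hq hm2 hx' hy' 1 (by simp) (by simpa using h2),
        nec_zero hp hq hm2 hx hy (by simpa using h1)⟩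
    · obtain ⟨⟨x, hx, y, hy, h1⟩, ⟨x', hx', y', hy', h2⟩⟩ :=
        h 0 ⟨le_refl _, by omega⟩ 0 ⟨le_refl _, by omega⟩
      exact ⟨nec_one hp hq hm2 hx' hy' (-1) (by simp) (by simpa using h2),
        nec_zero hp hq hm2 hx hy (by simpa using h1)⟩
  · rintro ⟨h1, h2⟩
    rw [le_div_iff₀ (by linarith)] at h2
    obtain ⟨M, hM⟩ : ∃ M : ℝ, (|(q : ℝ)| - 1) * M = |a| + (n - 1) :=
      ⟨(|a| + (n - 1)) / (|(q : ℝ)| - 1), mul_div_cancel₀ _ (by linarith)⟩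
    have ha : |a| ≤ (n - 1) + M := by
      by_contra hc
      push Not at hc
      nlinarith
    have hb : |(q : ℝ)| - |a| ≤ (n - 1) + M := by
      by_contra hc
      push Not at hc
      nlinarith
    have hzero := suff hp hq hm1 hn M hM ha 0 (by simpa using ha)
    have hone : |(q : ℝ) * 1 - a| ≤ (n - 1) + M ∨ |(q : ℝ) * (-1) - a| ≤ (n - 1) + M := by
      rcases abs_cases a with ⟨e1, e2⟩ | ⟨e1, e2⟩ <;>
      rcases abs_cases (q : ℝ) with ⟨f1, f2⟩ | ⟨f1, f2⟩ <;> rw [e1] at ha hb <;>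
        rw [f1] at hb hq'
      · left; rw [abs_le]; constructor <;> linarith
      · right; rw [abs_le]; constructor <;> linarith
      · right; rw [abs_le]; constructor <;> linarith
      · left; rw [abs_le]; constructor <;> linarith
    rcases hone with h | h
    · left
      have h' := suff hp hq hm1 hn M hM ha 1 h
      intro i _ j _
      exact ⟨by simpa using hzero, by simpa using h'⟩
    · right
      have h' := suff hp hq hm1 hn M hM ha (-1) h
      intro i _ j _
      exact ⟨by simpa using hzero, by simpa using h'⟩
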